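/- arXiv:1809.02917 — 6 statements merged into one kernel-verified Lean document; each statement's English description precedes it below -/
import Mathlib

section
/- Lemma (cheap links are filled first). Let h be any hybrid price matrix and let x* be an optimal solution of UPM(h). If for some user i and two distinct gateways j, k one has h_{i←j} + c_{i←j} < h_{i←k} + c_{i←k} and x*_{i←k} > 0, then downlink j is fully utilized, i.e., Σ_{l∈I} x*_{l←j} = C_j. -/
open Finset

/-- A traffic matrix `x` is feasible: nonnegative entries and downlink capacity constraints. -/
def Feasible {m : ℕ} (C : Fin m → ℝ) (x : Fin m → Fin m → ℝ) : Prop :=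
  (∀ i j, 0 ≤ x i j) ∧ ∀ j, ∑ i, x i j ≤ C j

/-- Users' total payoff in UPM(hp), with hybrid prices `hp` and energy costs `c`. -/
noncomputable def payoff {m : ℕ} (U : Fin m → ℝ → ℝ) (hp c : Fin m → Fin m → ℝ)
    (x : Fin m → Fin m → ℝ) : ℝ :=
  ∑ i, U i (∑ l, x i l) - ∑ i, ∑ j, (hp i j + c i j) * x i j

/-- `x` is an optimal solution of the users' payoff maximization problem UPM(hp). -/
def OptUPM {m : ℕ} (U : Fin m → ℝ → ℝ) (hp c : Fin m → Fin m → ℝ) (C : Fin m → ℝ)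
    (x : Fin m → Fin m → ℝ) : Prop :=
  Feasible C x ∧ ∀ y, Feasible C y → payoff U hp c y ≤ payoff U hp c x

/-- Total operator profit of the price matrix `hp` at traffic `x`, with operational costs `e`. -/
noncomputable def totalProfit {m : ℕ} (hp : Fin m → Fin m → ℝ) (e : Fin m → ℝ)
    (x : Fin m → Fin m → ℝ) : ℝ :=
  ∑ i, ∑ j, (hp i j - e j) * x i j

/-- Move `ε` units of user `i`'s traffic from downlink `k` to downlink `j`. -/
def shiftTraffic {m : ℕ} (x : Fin m → Fin m → ℝ) (i j k : Fin m) (ε : ℝ) :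
    Fin m → Fin m → ℝ :=
  fun a b => x a b + if a = i then (if b = j then ε else 0) - (if b = k then ε else 0) else 0

theorem sum_shiftTraffic_row {m : ℕ} (x : Fin m → Fin m → ℝ) (i j k : Fin m) (ε : ℝ)
    (a : Fin m) : ∑ b, shiftTraffic x i j k ε a b = ∑ b, x a b := by
  by_cases ha : a = i <;> simp [shiftTraffic, sum_add_distrib, ha]

theorem sum_shiftTraffic_col {m : ℕ} (x : Fin m → Fin m → ℝ) (i j k : Fin m) (ε : ℝ)
    (b : Fin m) : ∑ a, shiftTraffic x i j k ε a b =
      ∑ a, x a b + ((if b = j then ε else 0) - (if b = k then ε else 0)) := by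
  simp [shiftTraffic, sum_add_distrib]

theorem payoff_shiftTraffic {m : ℕ} (U : Fin m → ℝ → ℝ) (hp c x : Fin m → Fin m → ℝ)
    (i j k : Fin m) (ε : ℝ) :
    payoff U hp c (shiftTraffic x i j k ε) =
      payoff U hp c x + ε * ((hp i k + c i k) - (hp i j + c i j)) := by
  have hcost : ∑ a, ∑ b, (hp a b + c a b) * shiftTraffic x i j k ε a b =
      ∑ a, ∑ b, (hp a b + c a b) * x a b +
        ((hp i j + c i j) * ε - (hp i k + c i k) * ε) := by
    have hrow (a : Fin m) : ∑ b, (hp a b + c a b) * shiftTraffic x i j k ε a b =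
        ∑ b, (hp a b + c a b) * x a b +
          if a = i then (hp a j + c a j) * ε - (hp a k + c a k) * ε else 0 := by
      by_cases ha : a = i <;>
        simp [shiftTraffic, mul_add, mul_sub, sum_add_distrib, sum_sub_distrib, ha]
    simp only [hrow, sum_add_distrib, sum_ite_eq', mem_univ, if_true]
  simp only [payoff, sum_shiftTraffic_row, hcost]
  ring

theorem feasible_shiftTraffic {m : ℕ} {C : Fin m → ℝ} {x : Fin m → Fin m → ℝ}
    (hx : Feasible C x) {i j k : Fin m} {ε : ℝ} (hε : 0 ≤ ε) (hk : ε ≤ x i k)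
    (hj : ∑ a, x a j + ε ≤ C j) : Feasible C (shiftTraffic x i j k ε) := by
  refine ⟨fun a b => ?_, fun b => ?_⟩
  · have h := hx.1 a b
    unfold shiftTraffic
    split_ifs <;> subst_vars <;> linarith
  · have h := hx.2 b
    rw [sum_shiftTraffic_col]
    split_ifs <;> subst_vars <;> linarith

/-- **Lemma (cheap links are filled first).**  If `x` solves UPM(hp) and, for user `i`,
gateway `j` is strictly cheaper (price plus energy cost) than gateway `k`, while `x i k > 0`,
then downlink `j` is fully utilized. -/
theorem cheap_links_filled_first
    (m : ℕ) (hm : 0 < m)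
    (U U' : Fin m → ℝ → ℝ) (hp c : Fin m → Fin m → ℝ)
    (C : Fin m → ℝ) (hC : ∀ j, 0 < C j)
    (hc : ∀ i j, 0 ≤ c i j)
    (hUconc : ∀ i, StrictConcaveOn ℝ (Set.Ici (0:ℝ)) (U i))
    (hUmono : ∀ i, StrictMonoOn (U i) (Set.Ici (0:ℝ)))
    (hU' : ∀ i x, 0 ≤ x → HasDerivWithinAt (U i) (U' i x) (Set.Ici 0) x)
    (x : Fin m → Fin m → ℝ) (hx : OptUPM U hp c C x)
    (i j k : Fin m) (hjk : j ≠ k)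
    (hcheap : hp i j + c i j < hp i k + c i k)
    (hpos : 0 < x i k) :
    ∑ l, x l j = C j := by
  by_contra hne
  have hslack : 0 < C j - ∑ l, x l j := sub_pos.2 (lt_of_le_of_ne (hx.1.2 j) hne)
  have hε : 0 < min (x i k) (C j - ∑ l, x l j) := lt_min hpos hslack
  have hfeas : Feasible C (shiftTraffic x i j k (min (x i k) (C j - ∑ l, x l j))) :=
    feasible_shiftTraffic hx.1 hε.le (min_le_left _ _)
      (by linarith [min_le_right (x i k) (C j - ∑ l, x l j)])
  have hopt := hx.2 _ hfeas
  rw [payoff_shiftTraffic] at hopt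
  linarith [mul_pos hε (sub_pos.2 hcheap)]
end

section
/- Theorem (zero equilibrium shadow prices). Let h be a hybrid price matrix and (x*, λ, μ) a KKT point of UPM(h) with λ_j > 0 for some downlink j. Define h' by h'_{i←j} = h_{i←j} + λ_j for every user i and h'_{i←k} = h_{i←k} for every k ≠ j, and define λ' by λ'_j = 0 and λ'_k = λ_k for k ≠ j. Then (x*, λ', μ) is a KKT point of UPM(h'), so x* is still an optimal solution of UPM(h'); moreover the total operator profit strictly increases: Σ_{i,l}(h'_{i←l} − e_l) x*_{i←l} = Σ_{i,l}(h_{i←l} − e_l) x*_{i←l} + λ_j·C_j > Σ_{i,l}(h_{i←l} − e_l) x*_{i←l}. Consequently, a hybrid price matrix at which every system of KKT multipliers for the users' optimum has some strictly positive shadow price λ_j cannot maximize the operators' total profit. -/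
open Finset

/-- KKT point of UPM(hp): feasibility, nonnegative multipliers, stationarity,
and complementary slackness. -/
def KKTpoint {m : ℕ} (U' : Fin m → ℝ → ℝ) (hp c : Fin m → Fin m → ℝ) (C : Fin m → ℝ)
    (x : Fin m → Fin m → ℝ) (lam : Fin m → ℝ) (mu : Fin m → Fin m → ℝ) : Prop :=
  Feasible C x ∧ (∀ j, 0 ≤ lam j) ∧ (∀ i j, 0 ≤ mu i j) ∧
  (∀ i j, U' i (∑ l, x i l) - hp i j - c i j - lam j + mu i j = 0) ∧
  (∀ j, lam j * ((∑ i, x i j) - C j) = 0) ∧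
  (∀ i j, x i j * mu i j = 0)

/-- The graph of a concave function lies below each of its tangent lines. -/
theorem ConcaveOn.le_tangent_of_hasDerivWithinAt {S : Set ℝ} {f : ℝ → ℝ} {f' a b : ℝ}
    (hf : ConcaveOn ℝ S f) (ha : a ∈ S) (hb : b ∈ S) (hd : HasDerivWithinAt f f' S a) :
    f b ≤ f a + f' * (b - a) := by
  rcases lt_trichotomy a b with hab | rfl | hab
  · have h := hf.slope_le_of_hasDerivWithinAt ha hb hab hd
    rw [slope_def_field, div_le_iff₀ (sub_pos.2 hab)] at h
    linarith
  · simp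
  · have h := hf.le_slope_of_hasDerivWithinAt hb ha hab hd
    rw [slope_def_field, le_div_iff₀ (sub_pos.2 hab)] at h
    linarith

/-- On a capacity simplex the linear form with coefficients `g` attains the value
`max (0, max g) * C`. -/
theorem exists_weights_attaining_max {ι : Type*} [Fintype ι] (g : ι → ℝ) {C : ℝ}
    (hC : 0 ≤ C) :
    ∃ (l : ℝ) (w : ι → ℝ), 0 ≤ l ∧ (∀ i, g i ≤ l) ∧ (∀ i, 0 ≤ w i) ∧ ∑ i, w i ≤ C ∧
      ∑ i, g i * w i = l * C := by
  classical
  by_cases hg : ∀ i, g i ≤ 0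
  · exact ⟨0, 0, le_rfl, hg, fun _ => le_rfl, by simpa using hC, by simp⟩
  · push Not at hg
    obtain ⟨i, hi⟩ := hg
    obtain ⟨k, -, hk⟩ := Finset.exists_max_image Finset.univ g ⟨i, Finset.mem_univ i⟩
    refine ⟨g k, Pi.single k C, hi.le.trans (hk i (Finset.mem_univ i)),
      fun i => hk i (Finset.mem_univ i), fun i => ?_, ?_, ?_⟩
    · exact (Pi.single_nonneg.2 hC : (0 : ι → ℝ) ≤ Pi.single k C) i
    · simp
    · simp [Pi.single_apply]

section

variable {m : ℕ} {U U' : Fin m → ℝ → ℝ} {H c : Fin m → Fin m → ℝ} {C : Fin m → ℝ}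

/-- The users' payoff is bounded above by its first-order expansion. -/
theorem payoff_le_linearization
    (hUconc : ∀ i, ConcaveOn ℝ (Set.Ici (0:ℝ)) (U i))
    (hU' : ∀ i x, 0 ≤ x → HasDerivWithinAt (U i) (U' i x) (Set.Ici 0) x)
    {y z : Fin m → Fin m → ℝ} (hy : ∀ i j, 0 ≤ y i j) (hz : ∀ i j, 0 ≤ z i j) :
    payoff U H c z ≤ payoff U H c y +
      ∑ i, ∑ j, (U' i (∑ l, y i l) - H i j - c i j) * (z i j - y i j) := by
  have hU : ∀ i, U i (∑ l, z i l) ≤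
      U i (∑ l, y i l) + U' i (∑ l, y i l) * (∑ l, z i l - ∑ l, y i l) := fun i =>
    (hUconc i).le_tangent_of_hasDerivWithinAt (Finset.sum_nonneg fun l _ => hy i l)
      (Finset.sum_nonneg fun l _ => hz i l) (hU' i _ (Finset.sum_nonneg fun l _ => hy i l))
  have hsum := Finset.sum_le_sum fun i (_ : i ∈ Finset.univ) => hU i
  have hlin : ∑ i, ∑ j, (U' i (∑ l, y i l) - H i j - c i j) * (z i j - y i j) =
      ∑ i, U' i (∑ l, y i l) * (∑ l, z i l - ∑ l, y i l) -
        ∑ i, ∑ j, (H i j + c i j) * z i j + ∑ i, ∑ j, (H i j + c i j) * y i j := by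
    simp only [← Finset.sum_sub_distrib, Finset.mul_sum, ← Finset.sum_add_distrib]
    exact Finset.sum_congr rfl fun i _ => Finset.sum_congr rfl fun j _ => by ring
  rw [Finset.sum_add_distrib] at hsum
  unfold payoff
  linarith

/-- Sufficiency of the KKT conditions. -/
theorem KKTpoint.optUPM
    (hUconc : ∀ i, ConcaveOn ℝ (Set.Ici (0:ℝ)) (U i))
    (hU' : ∀ i x, 0 ≤ x → HasDerivWithinAt (U i) (U' i x) (Set.Ici 0) x)
    {y : Fin m → Fin m → ℝ} {l : Fin m → ℝ} {μ : Fin m → Fin m → ℝ}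
    (h : KKTpoint U' H c C y l μ) : OptUPM U H c C y := by
  obtain ⟨hy, hl, hμ, hstat, hcap, hcomp⟩ := h
  refine ⟨hy, fun z hz => ?_⟩
  have hle := payoff_le_linearization (H := H) (c := c) hUconc hU' hy.1 hz.1
  suffices ∑ i, ∑ j, (U' i (∑ l, y i l) - H i j - c i j) * (z i j - y i j) ≤ 0 by linarith
  have hterm : ∀ i j, (U' i (∑ l, y i l) - H i j - c i j) * (z i j - y i j) ≤
      l j * (z i j - y i j) := fun i j => by
    have := mul_nonneg (hμ i j) (hz.1 i j)
    linear_combination this + (z i j - y i j) * hstat i j + hcomp i j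
  calc _ ≤ ∑ i, ∑ j, l j * (z i j - y i j) :=
        Finset.sum_le_sum fun i _ => Finset.sum_le_sum fun j _ => hterm i j
    _ = ∑ j, l j * (∑ i, z i j - ∑ i, y i j) := by
        rw [Finset.sum_comm]
        simp only [← Finset.mul_sum, Finset.sum_sub_distrib]
    _ ≤ 0 := Finset.sum_nonpos fun j _ => by
        have := mul_nonneg (hl j) (sub_nonneg.2 (hz.2 j))
        linear_combination this - hcap j

theorem Feasible.segment {y z : Fin m → Fin m → ℝ} (hy : Feasible C y) (hz : Feasible C z)
    {t : ℝ} (ht : t ∈ Set.Icc (0:ℝ) 1) :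
    Feasible C fun i j => y i j + t * (z i j - y i j) := by
  have h1 : 0 ≤ 1 - t := sub_nonneg.2 ht.2
  refine ⟨fun i j => ?_, fun j => ?_⟩
  · linarith [mul_nonneg h1 (hy.1 i j), mul_nonneg ht.1 (hz.1 i j)]
  · rw [Finset.sum_add_distrib, ← Finset.mul_sum, Finset.sum_sub_distrib]
    linarith [mul_le_mul_of_nonneg_left (hy.2 j) h1, mul_le_mul_of_nonneg_left (hz.2 j) ht.1]

/-- The first-order optimality condition (variational inequality) for UPM. -/
theorem OptUPM.variational_inequality
    (hU' : ∀ i x, 0 ≤ x → HasDerivWithinAt (U i) (U' i x) (Set.Ici 0) x)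
    {y z : Fin m → Fin m → ℝ} (hy : OptUPM U H c C y) (hz : Feasible C z) :
    ∑ i, ∑ j, (U' i (∑ l, y i l) - H i j - c i j) * (z i j - y i j) ≤ 0 := by
  set p : ℝ → Fin m → Fin m → ℝ := fun t i j => y i j + t * (z i j - y i j) with hp
  have hp0 : p 0 = y := by simp [hp]
  have hentry : ∀ i j, HasDerivWithinAt (fun t => p t i j) (z i j - y i j) (Set.Icc 0 1) 0 :=
    fun i j => by
      simpa only [one_mul, id] using ((hasDerivWithinAt_id (0:ℝ) (Set.Icc 0 1)).mul_const
        (z i j - y i j)).const_add (y i j)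
  have hutil : ∀ i, HasDerivWithinAt (fun t => U i (∑ l, p t i l))
      (U' i (∑ l, y i l) * ∑ l, (z i l - y i l)) (Set.Icc 0 1) 0 := fun i => by
    refine HasDerivWithinAt.comp (h := fun t => ∑ l, p t i l) (h₂ := U i) 0
      (s' := Set.Ici 0) ?_ (HasDerivWithinAt.fun_sum fun l _ => hentry i l) fun t ht => ?_
    · rw [hp0]
      exact hU' i _ (Finset.sum_nonneg fun l _ => hy.1.1 i l)
    · exact Finset.sum_nonneg fun l _ => (hy.1.segment hz ht).1 i l
  have hderiv : HasDerivWithinAt (fun t => payoff U H c (p t))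
      (∑ i, U' i (∑ l, y i l) * ∑ l, (z i l - y i l) -
        ∑ i, ∑ j, (H i j + c i j) * (z i j - y i j)) (Set.Icc 0 1) 0 :=
    (HasDerivWithinAt.fun_sum fun i _ => hutil i).sub
      (HasDerivWithinAt.fun_sum fun i _ => HasDerivWithinAt.fun_sum fun j _ =>
        (hentry i j).const_mul _)
  have hmax : IsMaxOn (fun t => payoff U H c (p t)) (Set.Icc 0 1) 0 := fun t ht => by
    simpa only [Set.mem_ofPred_eq, hp0] using hy.2 _ (hy.1.segment hz ht)
  have hcone : (1:ℝ) ∈ posTangentConeAt (Set.Icc (0:ℝ) 1) 0 :=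
    mem_posTangentConeAt_of_segment_subset (by simp [segment_eq_Icc])
  have hle := hmax.localize.hasFDerivWithinAt_nonpos hderiv.hasFDerivWithinAt hcone
  simp only [ContinuousLinearMap.toSpanSingleton_apply, one_smul] at hle
  refine le_of_eq_of_le ?_ hle
  simp only [← Finset.sum_sub_distrib, Finset.mul_sum]
  exact Finset.sum_congr rfl fun i _ => Finset.sum_congr rfl fun j _ => by ring

/-- Necessity of the KKT conditions. -/
theorem OptUPM.exists_kktPoint (hC : ∀ j, 0 ≤ C j)
    (hU' : ∀ i x, 0 ≤ x → HasDerivWithinAt (U i) (U' i x) (Set.Ici 0) x)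
    {y : Fin m → Fin m → ℝ} (hy : OptUPM U H c C y) :
    ∃ l μ, KKTpoint U' H c C y l μ := by
  set g : Fin m → Fin m → ℝ := fun i j => U' i (∑ l, y i l) - H i j - c i j with hg
  choose l w hl hgl hw hwC hgw using fun j => exists_weights_attaining_max (fun i => g i j) (hC j)
  have hvi := hy.variational_inequality hU' (z := fun i j => w j i) ⟨fun i j => hw j i, hwC⟩
  have hμy : ∀ i j, 0 ≤ (l j - g i j) * y i j := fun i j =>
    mul_nonneg (sub_nonneg.2 (hgl j i)) (hy.1.1 i j)
  have hslack : ∀ j, 0 ≤ l j * (C j - ∑ i, y i j) := fun j =>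
    mul_nonneg (hl j) (sub_nonneg.2 (hy.1.2 j))
  have hcol : ∀ j, 0 ≤ l j * (C j - ∑ i, y i j) + ∑ i, (l j - g i j) * y i j := fun j =>
    add_nonneg (hslack j) (Finset.sum_nonneg fun i _ => hμy i j)
  have hsum : ∑ j, (l j * (C j - ∑ i, y i j) + ∑ i, (l j - g i j) * y i j) =
      ∑ i, ∑ j, g i j * (w j i - y i j) := by
    rw [Finset.sum_comm (f := fun i j => g i j * (w j i - y i j))]
    refine Finset.sum_congr rfl fun j _ => ?_
    simp only [mul_sub, sub_mul, Finset.sum_sub_distrib, hgw, ← Finset.mul_sum]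
    ring
  have hzero := (Finset.sum_eq_zero_iff_of_nonneg fun j _ => hcol j).1
    (le_antisymm (hsum.trans_le hvi) (Finset.sum_nonneg fun j _ => hcol j))
  have hsplit := fun j => (add_eq_zero_iff_of_nonneg (hslack j)
    (Finset.sum_nonneg fun i _ => hμy i j)).1 (hzero j (Finset.mem_univ j))
  refine ⟨l, fun i j => l j - g i j, hy.1, hl, fun i j => sub_nonneg.2 (hgl j i),
    fun i j => by simp only [hg]; ring, fun j => by linear_combination -(hsplit j).1,
    fun i j => ?_⟩
  rw [mul_comm]
  exact (Finset.sum_eq_zero_iff_of_nonneg fun i _ => hμy i j).1 (hsplit j).2 i (Finset.mem_univ i)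

/-- A shadow price can be absorbed into the prices of its downlink. -/
theorem KKTpoint.absorb_shadow_price {y : Fin m → Fin m → ℝ} {l : Fin m → ℝ}
    {μ : Fin m → Fin m → ℝ} (h : KKTpoint U' H c C y l μ) (k : Fin m) :
    KKTpoint U' (fun i j => if j = k then H i j + l k else H i j) c C y
      (fun j => if j = k then 0 else l j) μ := by
  obtain ⟨hy, hl, hμ, hstat, hcap, hcomp⟩ := h
  refine ⟨hy, fun j => ?_, hμ, fun i j => ?_, fun j => ?_, hcomp⟩
  · dsimp only
    split_ifs
    exacts [le_rfl, hl j]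
  · have := hstat i j
    dsimp only
    split_ifs with hjk
    · subst hjk
      linarith
    · exact this
  · dsimp only
    split_ifs
    exacts [zero_mul _, hcap j]

/-- Absorbing a shadow price raises the profit by the shadow price times the capacity. -/
theorem KKTpoint.totalProfit_absorb_shadow_price {y : Fin m → Fin m → ℝ} {l : Fin m → ℝ}
    {μ : Fin m → Fin m → ℝ} (h : KKTpoint U' H c C y l μ) (e : Fin m → ℝ) (k : Fin m) :
    totalProfit (fun i j => if j = k then H i j + l k else H i j) e y =
      totalProfit H e y + l k * C k := by
  have hrow : ∀ i, ∑ j, ((if j = k then H i j + l k else H i j) - e j) * y i j =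
      ∑ j, (H i j - e j) * y i j + l k * y i k := fun i => by
    have : ∀ j, ((if j = k then H i j + l k else H i j) - e j) * y i j =
        (H i j - e j) * y i j + if j = k then l k * y i j else 0 := fun j => by
      split_ifs <;> ring
    simp [this, Finset.sum_add_distrib]
  simp only [totalProfit, hrow, Finset.sum_add_distrib, ← Finset.mul_sum]
  linear_combination h.2.2.2.2.1 k

end

/-- **Theorem (zero equilibrium shadow prices).**  If `(x, lam, mu)` is a KKT point of
UPM(hp) with `lam j0 > 0`, raising the prices on downlink `j0` by `lam j0` yields a price
matrix `hp'` for which `(x, lam', mu)` is again a KKT point (so `x` still solves UPM(hp')),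
and the total operator profit strictly increases by `lam j0 * C j0`.  Consequently a price
matrix all of whose users' KKT multiplier systems have some strictly positive shadow price
cannot maximize the operators' total profit. -/
theorem zero_shadow_prices
    (m : ℕ) (hm : 0 < m)
    (U U' : Fin m → ℝ → ℝ) (hp c : Fin m → Fin m → ℝ)
    (C e : Fin m → ℝ) (hC : ∀ j, 0 < C j) (he : ∀ j, 0 ≤ e j)
    (hc : ∀ i j, 0 ≤ c i j)
    (hUconc : ∀ i, StrictConcaveOn ℝ (Set.Ici (0:ℝ)) (U i))
    (hUmono : ∀ i, StrictMonoOn (U i) (Set.Ici (0:ℝ)))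
    (hU' : ∀ i x, 0 ≤ x → HasDerivWithinAt (U i) (U' i x) (Set.Ici 0) x)
    (x : Fin m → Fin m → ℝ) (lam : Fin m → ℝ) (mu : Fin m → Fin m → ℝ)
    (hKKT : KKTpoint U' hp c C x lam mu)
    (j0 : Fin m) (hj0 : 0 < lam j0)
    (hp' : Fin m → Fin m → ℝ)
    (hhp' : ∀ i k, hp' i k = if k = j0 then hp i k + lam j0 else hp i k)
    (lam' : Fin m → ℝ)
    (hlam' : ∀ k, lam' k = if k = j0 then 0 else lam k) :
    KKTpoint U' hp' c C x lam' mu ∧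
    OptUPM U hp' c C x ∧
    totalProfit hp' e x = totalProfit hp e x + lam j0 * C j0 ∧
    totalProfit hp e x < totalProfit hp' e x ∧
    ∀ H : Fin m → Fin m → ℝ,
      (∀ y l μ, KKTpoint U' H c C y l μ → ∃ k, 0 < l k) →
      ∀ y, OptUPM U H c C y →
        ∃ H' y', OptUPM U H' c C y' ∧ totalProfit H e y < totalProfit H' e y' := by
  have hconc := fun i => (hUconc i).concaveOn
  obtain rfl : hp' = fun i k => if k = j0 then hp i k + lam j0 else hp i k :=
    funext fun i => funext fun k => hhp' i k
  obtain rfl : lam' = fun k => if k = j0 then 0 else lam k := funext hlam'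
  have hprofit := hKKT.totalProfit_absorb_shadow_price e j0
  refine ⟨hKKT.absorb_shadow_price j0, (hKKT.absorb_shadow_price j0).optUPM hconc hU', hprofit,
    hprofit ▸ lt_add_of_pos_right _ (mul_pos hj0 (hC j0)), fun H hH y hy => ?_⟩
  obtain ⟨l, μ, hlμ⟩ := hy.exists_kktPoint (fun j => (hC j).le) hU'
  obtain ⟨k, hk⟩ := hH y l μ hlμ
  refine ⟨_, y, (hlμ.absorb_shadow_price k).optUPM hconc hU', ?_⟩
  rw [hlμ.totalProfit_absorb_shadow_price e k]
  exact lt_add_of_pos_right _ (mul_pos hk (hC k))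
end

section
/- Proposition (zero demand for low-value users). Suppose user i satisfies U_i'(0) ≤ min_{j∈I} (c_{i←j} + e_j), and the hybrid price matrix h satisfies h_{i←j} ≥ e_j for every gateway j. Then every optimal solution x* of UPM(h) has x*_{i←j} = 0 for all j ∈ I, i.e., user i has zero demand. -/
open Finset

/-- A strictly concave function on `[0, ∞)` lies strictly below its tangent line at `0`. -/
theorem StrictConcaveOn.sub_lt_mul_of_hasDerivWithinAt_zero {f : ℝ → ℝ} {f' s : ℝ}
    (hf : StrictConcaveOn ℝ (Set.Ici 0) f) (hf' : HasDerivWithinAt f f' (Set.Ici 0) 0)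
    (hs : 0 < s) : f s - f 0 < f' * s := by
  have h := hf.slope_lt_of_hasDerivWithinAt_Ioi Set.self_mem_Ici (Set.mem_Ici.2 hs.le) hs
    (hf'.mono Set.Ioi_subset_Ici_self)
  rwa [slope_def_field, sub_zero, div_lt_iff₀ hs] at h

theorem Feasible.update_zero {m : ℕ} {C : Fin m → ℝ} {x : Fin m → Fin m → ℝ}
    (hx : Feasible C x) (i : Fin m) : Feasible C (Function.update x i 0) := by
  have hle : ∀ k j, Function.update x i 0 k j ≤ x k j := by
    intro k j
    rcases eq_or_ne k i with rfl | hk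
    · simpa using hx.1 k j
    · simp [hk]
  refine ⟨fun k j => ?_, fun j => (Finset.sum_le_sum fun k _ => hle k j).trans (hx.2 j)⟩
  rcases eq_or_ne k i with rfl | hk
  · simp
  · simpa [hk] using hx.1 k j

theorem payoff_sub_payoff_update_zero {m : ℕ} (U : Fin m → ℝ → ℝ)
    (hp c x : Fin m → Fin m → ℝ) (i : Fin m) :
    payoff U hp c x - payoff U hp c (Function.update x i 0) =
      U i (∑ l, x i l) - U i 0 - ∑ j, (hp i j + c i j) * x i j := by
  simp only [payoff, ← Finset.sum_sub_distrib]
  rw [Finset.sum_eq_single i]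
  · simp
    ring
  · intro k _ hk
    simp [hk]
  · simp

/-- **Proposition (zero demand for low-value users).**  If user `i`'s marginal utility at 0
does not exceed `c i j + e j` for every gateway `j` (i.e. it is at most the minimum delivered
cost) and the hybrid prices on user `i`'s links are at least the operational costs, then at
every optimal solution of UPM(hp) user `i` has zero demand. -/
theorem zero_demand_for_low_value_users
    (m : ℕ) (hm : 0 < m)
    (U U' : Fin m → ℝ → ℝ) (hp c : Fin m → Fin m → ℝ)
    (C e : Fin m → ℝ) (hC : ∀ j, 0 < C j) (he : ∀ j, 0 ≤ e j)
    (hc : ∀ i j, 0 ≤ c i j)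
    (hUconc : ∀ i, StrictConcaveOn ℝ (Set.Ici (0:ℝ)) (U i))
    (hUmono : ∀ i, StrictMonoOn (U i) (Set.Ici (0:ℝ)))
    (hU' : ∀ i x, 0 ≤ x → HasDerivWithinAt (U i) (U' i x) (Set.Ici 0) x)
    (i : Fin m)
    (hlow : ∀ j, U' i 0 ≤ c i j + e j)
    (hprice : ∀ j, e j ≤ hp i j)
    (x : Fin m → Fin m → ℝ) (hx : OptUPM U hp c C x) :
    ∀ j, x i j = 0 := by
  have hnn : ∀ l, 0 ≤ x i l := hx.1.1 i
  have hsum : ∑ l, x i l = 0 := by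
    by_contra hne
    have hpos : 0 < ∑ l, x i l :=
      lt_of_le_of_ne (Finset.sum_nonneg fun l _ => hnn l) (Ne.symm hne)
    have hopt := hx.2 _ (hx.1.update_zero i)
    have hdiff := payoff_sub_payoff_update_zero U hp c x i
    have htangent := (hUconc i).sub_lt_mul_of_hasDerivWithinAt_zero (hU' i 0 le_rfl) hpos
    have hcost : U' i 0 * ∑ l, x i l ≤ ∑ j, (hp i j + c i j) * x i j := by
      rw [Finset.mul_sum]
      exact Finset.sum_le_sum fun j _ =>
        mul_le_mul_of_nonneg_right (by linarith [hlow j, hprice j]) (hnn j)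
    linarith
  intro j
  exact (Finset.sum_eq_zero_iff_of_nonneg fun l _ => hnn l).1 hsum j (Finset.mem_univ j)
end

section
/- Corollary (optimality of free tethering). Suppose the users' Wi-Fi energy costs are zero and all cellular downlink energy costs are equal, so that c_{i←j} = c ≥ 0 for all users i and gateways j, and suppose each user i has the isoelastic utility U_i(x) = (θ_i·x^{1−α} + Ξ_i)/(1−α) with θ_i > 0, Ξ_i ≥ 0 and α ∈ (0,1). Then there exists an optimal hybrid price matrix h* for the cooperative operator profit maximization problem (OPM) whose delivered prices p_i* = h*_{i←j} + c are equal across all users i and all gateways j; equivalently, the optimal hybrid pricing can be taken with zero tethering prices, i.e., h*_{i←j} = a* for all i, j, for a single access price a*. -/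
open Finset

/-- Bernoulli's inequality, rescaled: the linear-cost isoelastic payoff has a strict maximum at the
point where marginal utility equals the price. -/
lemma isoelastic_payoff_lt {β θ p x₀ x : ℝ} (hβ : 0 < β) (hβ' : β < 1) (hp : 0 < p)
    (hx₀ : 0 < x₀) (h : θ * x₀ ^ β = p * x₀) (hx : 0 ≤ x) (hne : x ≠ x₀) :
    θ * x ^ β / β - p * x < θ * x₀ ^ β / β - p * x₀ := by
  have hr : 0 ≤ x / x₀ := by positivity
  have hb : (x / x₀) ^ β < 1 + β * (x / x₀ - 1) := by
    have := rpow_one_add_lt_one_add_mul_self (s := x / x₀ - 1) (p := β) (by linarith)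
      (by rw [sub_ne_zero, Ne, div_eq_one_iff_eq hx₀.ne']; exact hne) hβ hβ'
    simpa using this
  have hx_eq : x = x / x₀ * x₀ := by field_simp
  have hpow : θ * x ^ β = p * x₀ * (x / x₀) ^ β := by
    conv_lhs => rw [hx_eq, Real.mul_rpow hr hx₀.le]
    rw [← h]; ring
  have hlt : p * x₀ * (x / x₀) ^ β / β < p * x₀ * (1 + β * (x / x₀ - 1)) / β := by
    gcongr
  have hrw : p * x₀ * (1 + β * (x / x₀ - 1)) / β = p * x₀ / β + p * x - p * x₀ := by
    field_simp
    ring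
  rw [hpow, h]
  linarith

/-- A first-order condition at the right endpoint of `[0, 1]`. -/
lemma le_of_mul_one_sub_le_rpow {β P K : ℝ} (hβ : 0 < β)
    (h : ∀ s ∈ Set.Ioo (0 : ℝ) 1, P * (1 - s) ≤ K / β * (1 - s ^ β)) : P ≤ K := by
  have hd : HasDerivAt (fun s : ℝ => K / β * s ^ β) K 1 := by
    have := (Real.hasDerivAt_rpow_const (x := 1) (p := β) (Or.inl one_ne_zero)).const_mul (K / β)
    simpa [hβ.ne'] using this
  have ht := (hasDerivAt_iff_tendsto_slope.1 hd).mono_left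
    (nhdsWithin_mono 1 (fun s (hs : s < 1) => hs.ne) : nhdsWithin (1 : ℝ) (Set.Iio 1) ≤ _)
  refine ge_of_tendsto ht ?_
  filter_upwards [Ioo_mem_nhdsLT (zero_lt_one' ℝ)] with s hs
  rw [slope_comm, slope_def_field, le_div_iff₀ (by linarith [hs.2])]
  have := h s hs
  simp only [Real.one_rpow]
  linarith

/-- Hölder's inequality for weighted sums of powers. -/
lemma sum_rpow_mul_rpow_le {ι : Type*} (s : Finset ι) {α : ℝ} (hα : α ∈ Set.Ioo (0 : ℝ) 1)
    {w X : ι → ℝ} (hw : ∀ i, 0 ≤ w i) (hX : ∀ i, 0 ≤ X i) :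
    ∑ i ∈ s, w i ^ α * X i ^ (1 - α) ≤ (∑ i ∈ s, w i) ^ α * (∑ i ∈ s, X i) ^ (1 - α) := by
  have h1 : 0 < α := hα.1
  have h2 : 0 < 1 - α := sub_pos.2 hα.2
  have hpq : Real.HolderConjugate (1 / α) (1 / (1 - α)) := by
    rw [Real.holderConjugate_iff]
    refine ⟨by rw [lt_div_iff₀ h1]; linarith [hα.2], by simp⟩
  have := Real.inner_le_Lp_mul_Lq_of_nonneg s hpq (f := fun i => w i ^ α)
    (g := fun i => X i ^ (1 - α)) (fun i _ => Real.rpow_nonneg (hw i) _)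
    (fun i _ => Real.rpow_nonneg (hX i) _)
  have e1 : ∀ i, (w i ^ α) ^ (1 / α) = w i := fun i => by
    rw [one_div, Real.rpow_rpow_inv (hw i) h1.ne']
  have e2 : ∀ i, (X i ^ (1 - α)) ^ (1 / (1 - α)) = X i := fun i => by
    rw [one_div, Real.rpow_rpow_inv (hX i) h2.ne']
  simpa only [e1, e2, one_div_one_div] using this

/-- Near zero, a sublinear power dominates a linear term. -/
lemma exists_rpow_sub_mul_pos {α K : ℝ} (hα : 0 < α) (hK : 0 < K) (D : ℝ) :
    ∃ s ∈ Set.Ioo (0 : ℝ) 1, 0 < K * s ^ (1 - α) - D * s := by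
  have ht : Filter.Tendsto (fun s : ℝ => D * s ^ α) (nhdsWithin 0 (Set.Ioi 0)) (nhds 0) := by
    have hc : ContinuousAt (fun s : ℝ => D * s ^ α) 0 :=
      continuousAt_const.mul (Real.continuousAt_rpow_const 0 α (Or.inr hα.le))
    have := hc.tendsto
    simp only [Real.zero_rpow hα.ne', mul_zero] at this
    exact this.mono_left nhdsWithin_le_nhds
  obtain ⟨s, hs, hs'⟩ :=
    ((ht.eventually_lt_const hK).and (Ioo_mem_nhdsGT (zero_lt_one' ℝ))).exists
  refine ⟨s, hs', ?_⟩
  have hsplit : s = s ^ α * s ^ (1 - α) := by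
    rw [← Real.rpow_add hs'.1]; simp
  have hpos : 0 < s ^ (1 - α) := Real.rpow_pos_of_pos hs'.1 _
  have : K * s ^ (1 - α) - D * s = (K - D * s ^ α) * s ^ (1 - α) := by
    nth_rewrite 2 [hsplit]
    ring
  rw [this]
  exact mul_pos (sub_pos.2 hs) hpos

/-- The operators' reduced profit, as a function of the vector `Y` of downlink loads. -/
noncomputable def reducedProfit {m : ℕ} (W α c : ℝ) (e Y : Fin m → ℝ) : ℝ :=
  W ^ α * (∑ j, Y j) ^ (1 - α) - ∑ j, (e j + c) * Y j

lemma exists_isMaxOn_reducedProfit {m : ℕ} (hm : 0 < m) {W α c : ℝ} (hW : 0 < W)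
    (hα : α ∈ Set.Ioo (0 : ℝ) 1) (e : Fin m → ℝ) {C : Fin m → ℝ} (hC : ∀ j, 0 < C j) :
    ∃ Y ∈ Set.Icc 0 C, IsMaxOn (reducedProfit W α c e) (Set.Icc 0 C) Y ∧ 0 < ∑ j, Y j ∧
      0 < reducedProfit W α c e Y := by
  have : Nonempty (Fin m) := ⟨⟨0, hm⟩⟩
  have h2 : 0 < 1 - α := sub_pos.2 hα.2
  have hcont : Continuous (reducedProfit (m := m) W α c e) := by
    unfold reducedProfit
    refine (continuous_const.mul ?_).sub (by fun_prop)
    exact (continuous_finsetSum _ fun j _ => continuous_apply j).rpow_const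
      fun _ => Or.inr h2.le
  obtain ⟨Y, hY, hmax⟩ := isCompact_Icc.exists_isMaxOn
    (Set.nonempty_Icc.2 fun j => (hC j).le : (Set.Icc (0 : Fin m → ℝ) C).Nonempty)
    hcont.continuousOn
  have hsum : 0 < ∑ j, C j := Finset.sum_pos (fun j _ => hC j) Finset.univ_nonempty
  obtain ⟨s, hs, hpos⟩ := exists_rpow_sub_mul_pos hα.1
    (show 0 < W ^ α * (∑ j, C j) ^ (1 - α) by positivity) (∑ j, (e j + c) * C j)
  have hmem : (fun j => s * C j) ∈ Set.Icc (0 : Fin m → ℝ) C :=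
    ⟨fun j => mul_nonneg hs.1.le (hC j).le, fun j => by nlinarith [hC j, hs.2]⟩
  have hscale : reducedProfit W α c e (fun j => s * C j)
      = W ^ α * (∑ j, C j) ^ (1 - α) * s ^ (1 - α) - (∑ j, (e j + c) * C j) * s := by
    rw [reducedProfit, ← Finset.mul_sum, Real.mul_rpow hs.1.le hsum.le, Finset.sum_mul]
    congr 1
    · ring
    · exact Finset.sum_congr rfl fun j _ => by ring
  have hval : 0 < reducedProfit W α c e Y := (hscale ▸ hpos).trans_le (hmax hmem)
  refine ⟨Y, hY, hmax, ?_, hval⟩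
  have hnn : ∀ j ∈ Finset.univ, 0 ≤ Y j := fun j _ => hY.1 j
  refine (Finset.sum_nonneg hnn).lt_of_ne' fun h0 => ?_
  have hz : ∀ j, Y j = 0 := fun j => (Finset.sum_eq_zero_iff_of_nonneg hnn).1 h0 j (by simp)
  simp [reducedProfit, hz, Real.zero_rpow h2.ne'] at hval

/-- Proportionally scaling down optimal traffic bounds what the users pay by their total marginal
valuation. -/
lemma OptUPM.sum_price_le {m : ℕ} {U : Fin m → ℝ → ℝ} {θ Ξ : Fin m → ℝ} {α : ℝ}
    (hα : α ∈ Set.Ioo (0 : ℝ) 1)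
    (hU : ∀ i x, 0 ≤ x → U i x = (θ i * x ^ (1 - α) + Ξ i) / (1 - α))
    {hp c x : Fin m → Fin m → ℝ} {C : Fin m → ℝ} (hx : OptUPM U hp c C x) :
    ∑ i, ∑ j, (hp i j + c i j) * x i j ≤ ∑ i, θ i * (∑ j, x i j) ^ (1 - α) := by
  have h2 : 0 < 1 - α := sub_pos.2 hα.2
  obtain ⟨⟨hx0, hxC⟩, hopt⟩ := hx
  have hX : ∀ i, 0 ≤ ∑ j, x i j := fun i => Finset.sum_nonneg fun j _ => hx0 i j
  refine le_of_mul_one_sub_le_rpow h2 fun s hs => ?_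
  have hfeas : Feasible C fun i j => s * x i j := by
    refine ⟨fun i j => mul_nonneg hs.1.le (hx0 i j), fun j => ?_⟩
    rw [← Finset.mul_sum]
    refine le_trans ?_ (hxC j)
    exact mul_le_of_le_one_left (Finset.sum_nonneg fun i _ => hx0 i j) hs.2.le
  have key := hopt _ hfeas
  have hUs : ∀ i, U i (∑ j, s * x i j)
      = U i (∑ j, x i j) - θ i * (∑ j, x i j) ^ (1 - α) * ((1 - s ^ (1 - α)) / (1 - α)) := by
    intro i
    rw [← Finset.mul_sum, hU _ _ (mul_nonneg hs.1.le (hX i)), hU _ _ (hX i),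
      Real.mul_rpow hs.1.le (hX i)]
    field_simp
    ring
  have hpay : ∑ i, ∑ j, (hp i j + c i j) * (s * x i j)
      = s * ∑ i, ∑ j, (hp i j + c i j) * x i j := by
    simp only [Finset.mul_sum]
    exact Finset.sum_congr rfl fun i _ => Finset.sum_congr rfl fun j _ => by ring
  simp only [payoff, hUs, hpay, Finset.sum_sub_distrib, ← Finset.sum_mul] at key
  have : (∑ i, θ i * (∑ j, x i j) ^ (1 - α)) * ((1 - s ^ (1 - α)) / (1 - α))
      = (∑ i, θ i * (∑ j, x i j) ^ (1 - α)) / (1 - α) * (1 - s ^ (1 - α)) := by ring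
  linarith

/-- Under any price matrix, total profit is at most the reduced profit of the downlink loads. -/
lemma OptUPM.totalProfit_le {m : ℕ} {U : Fin m → ℝ → ℝ} {w Ξ : Fin m → ℝ} {α : ℝ}
    (hα : α ∈ Set.Ioo (0 : ℝ) 1) (hw : ∀ i, 0 ≤ w i)
    (hU : ∀ i x, 0 ≤ x → U i x = (w i ^ α * x ^ (1 - α) + Ξ i) / (1 - α))
    {hp x : Fin m → Fin m → ℝ} {c : ℝ} {C : Fin m → ℝ} (e : Fin m → ℝ)
    (hx : OptUPM U hp (fun _ _ => c) C x) :
    totalProfit hp e x ≤ reducedProfit (∑ i, w i) α c e fun j => ∑ i, x i j := by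
  have h1 := hx.sum_price_le hα hU
  have h2 := sum_rpow_mul_rpow_le Finset.univ hα hw
    (X := fun i => ∑ j, x i j) fun i => Finset.sum_nonneg fun j _ => hx.1.1 i j
  have hcost : ∑ j, (e j + c) * ∑ i, x i j = ∑ i, ∑ j, (e j + c) * x i j := by
    rw [Finset.sum_comm]
    simp only [Finset.mul_sum]
  have hsplit : totalProfit hp e x
      = ∑ i, ∑ j, (hp i j + c) * x i j - ∑ i, ∑ j, (e j + c) * x i j := by
    simp only [totalProfit, ← Finset.sum_sub_distrib]
    exact Finset.sum_congr rfl fun i _ => Finset.sum_congr rfl fun j _ => by ring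
  rw [hsplit, reducedProfit, hcost, Finset.sum_comm (f := fun j i => x i j)]
  linarith

lemma payoff_const_price {m : ℕ} (U : Fin m → ℝ → ℝ) (a c : ℝ) (x : Fin m → Fin m → ℝ) :
    payoff U (fun _ _ => a) (fun _ _ => c) x
      = ∑ i, (U i (∑ j, x i j) - (a + c) * ∑ j, x i j) := by
  simp only [payoff, Finset.sum_sub_distrib, Finset.mul_sum]

/-- If the individual strict payoff maximizers are jointly feasible under a constant price, they are
optimal and every optimal traffic has the same per-user totals. -/
lemma optUPM_const_price {m : ℕ} {U : Fin m → ℝ → ℝ} {a c : ℝ} {C : Fin m → ℝ}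
    {y : Fin m → Fin m → ℝ} (hy : Feasible C y)
    (hlt : ∀ i x, 0 ≤ x → x ≠ ∑ j, y i j →
      U i x - (a + c) * x < U i (∑ j, y i j) - (a + c) * ∑ j, y i j) :
    OptUPM U (fun _ _ => a) (fun _ _ => c) C y ∧
      ∀ x, OptUPM U (fun _ _ => a) (fun _ _ => c) C x → ∀ i, ∑ j, x i j = ∑ j, y i j := by
  have hle : ∀ x : Fin m → Fin m → ℝ, Feasible C x → ∀ i ∈ Finset.univ,
      U i (∑ j, x i j) - (a + c) * ∑ j, x i j ≤ U i (∑ j, y i j) - (a + c) * ∑ j, y i j := by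
    intro x hx i _
    by_cases h : ∑ j, x i j = ∑ j, y i j
    · rw [h]
    · exact (hlt i _ (Finset.sum_nonneg fun j _ => hx.1 i j) h).le
  refine ⟨⟨hy, fun x hx => ?_⟩, fun x hx i => ?_⟩
  · simpa only [payoff_const_price] using Finset.sum_le_sum (hle x hx)
  · by_contra h
    have hopt := hx.2 y hy
    simp only [payoff_const_price] at hopt
    exact (Finset.sum_lt_sum (hle x hx.1)
      ⟨i, Finset.mem_univ i, hlt i _ (Finset.sum_nonneg fun j _ => hx.1.1 i j) h⟩).not_ge hopt

/-- **Corollary (optimality of free tethering).**  Suppose all energy costs are a common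
constant `c ≥ 0` (zero Wi-Fi cost and equal cellular downlink cost) and each user has an
isoelastic utility `U i x = (θ i * x^(1-α) + Ξ i)/(1-α)` with `θ i > 0`, `Ξ i ≥ 0`,
`α ∈ (0,1)`.  With `xs` the users' optimal-traffic selection (Assumption 1), there exists an
optimal nonnegative hybrid price matrix for the cooperative operator profit maximization
problem (OPM) which is constant, i.e. realizable with a single access price and zero
tethering prices. -/
theorem free_tethering_optimal
    (m : ℕ) (hm : 0 < m)
    (U : Fin m → ℝ → ℝ)
    (θ Ξ : Fin m → ℝ) (hθ : ∀ i, 0 < θ i) (hΞ : ∀ i, 0 ≤ Ξ i)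
    (α : ℝ) (hα : α ∈ Set.Ioo (0:ℝ) 1)
    (hUdef : ∀ i x, 0 ≤ x → U i x = (θ i * x ^ (1 - α) + Ξ i) / (1 - α))
    (c : ℝ) (hc : 0 ≤ c)
    (e C : Fin m → ℝ) (he : ∀ j, 0 ≤ e j) (hC : ∀ j, 0 < C j)
    (xs : (Fin m → Fin m → ℝ) → Fin m → Fin m → ℝ)
    (hxs : ∀ hp, OptUPM U hp (fun _ _ => c) C (xs hp) ∧
      ∀ y, OptUPM U hp (fun _ _ => c) C y →
        (∑ i, ∑ j, (e j + c) * xs hp i j) ≤ ∑ i, ∑ j, (e j + c) * y i j) :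
    ∃ hstar : Fin m → Fin m → ℝ,
      (∀ i j, 0 ≤ hstar i j) ∧
      (∀ h' : Fin m → Fin m → ℝ, (∀ i j, 0 ≤ h' i j) →
        totalProfit h' e (xs h') ≤ totalProfit hstar e (xs hstar)) ∧
      ∃ a : ℝ, ∀ i j, hstar i j = a := by
  have : Nonempty (Fin m) := ⟨⟨0, hm⟩⟩
  have hα0 : 0 < α := hα.1
  have hβ : 0 < 1 - α := sub_pos.2 hα.2
  set w : Fin m → ℝ := fun i => θ i ^ α⁻¹ with hw_def
  have hw : ∀ i, 0 < w i := fun i => Real.rpow_pos_of_pos (hθ i) _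
  have hθw : ∀ i, θ i = w i ^ α := fun i => (Real.rpow_inv_rpow (hθ i).le hα0.ne').symm
  set W := ∑ i, w i with hW_def
  have hW : 0 < W := Finset.sum_pos (fun i _ => hw i) Finset.univ_nonempty
  obtain ⟨Y, hY, hmax, hT, hpos⟩ :=
    exists_isMaxOn_reducedProfit (c := c) hm hW hα e hC
  set T := ∑ j, Y j with hT_def
  set p := (W / T) ^ α with hp_def
  have hp : 0 < p := Real.rpow_pos_of_pos (div_pos hW hT) _
  have hpT : W ^ α * T ^ (1 - α) = p * T := by
    rw [hp_def, Real.div_rpow hW.le hT.le, Real.rpow_sub hT, Real.rpow_one]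
    ring
  have hYval : reducedProfit W α c e Y = p * T - ∑ j, (e j + c) * Y j := by
    rw [reducedProfit, ← hT_def, hpT]
  have hcp : c ≤ p := by
    have h1 : c * T ≤ ∑ j, (e j + c) * Y j := by
      rw [hT_def, Finset.mul_sum]
      exact Finset.sum_le_sum fun j _ =>
        mul_le_mul_of_nonneg_right (by linarith [he j]) (hY.1 j)
    exact le_of_mul_le_mul_right (by linarith) hT
  set y : Fin m → Fin m → ℝ := fun i j => w i / W * Y j with hy_def
  have hrow : ∀ i, ∑ j, y i j = w i * (T / W) := fun i => by
    simp only [hy_def, ← Finset.mul_sum, ← hT_def]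
    ring
  have hcol : ∀ j, ∑ i, y i j = Y j := fun j => by
    simp only [hy_def, ← Finset.sum_mul, ← Finset.sum_div, ← hW_def]
    rw [div_self hW.ne', one_mul]
  have hyF : Feasible C y :=
    ⟨fun i j => mul_nonneg (div_pos (hw i) hW).le (hY.1 j), fun j => (hcol j).trans_le (hY.2 j)⟩
  have hfoc : ∀ i, θ i * (w i * (T / W)) ^ (1 - α) = p * (w i * (T / W)) := fun i => by
    have hTW : 0 < T / W := div_pos hT hW
    rw [hθw, hp_def, ← inv_div T W, Real.inv_rpow hTW.le, Real.mul_rpow (hw i).le hTW.le,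
      Real.rpow_sub (hw i), Real.rpow_sub hTW, Real.rpow_one, Real.rpow_one]
    have h1 := (Real.rpow_pos_of_pos (hw i) α).ne'
    field_simp
  obtain ⟨hyopt, huniq⟩ := optUPM_const_price (U := U) (a := p - c) (c := c) hyF (by
    intro i x hx hne
    have hx₀ : 0 < w i * (T / W) := mul_pos (hw i) (div_pos hT hW)
    rw [hrow] at hne ⊢
    have := isoelastic_payoff_lt hβ (by linarith) hp hx₀ (hfoc i) hx hne
    rw [hUdef i x hx, hUdef i _ hx₀.le, add_div, add_div, sub_add_cancel]
    linarith)
  refine ⟨fun _ _ => p - c, fun _ _ => sub_nonneg.2 hcp, fun h' _ => ?_, p - c, fun _ _ => rfl⟩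
  have hup : totalProfit h' e (xs h') ≤ reducedProfit W α c e Y := by
    obtain ⟨hx, -⟩ := hxs h'
    refine (hx.totalProfit_le hα (fun i => (hw i).le)
      (fun i x hx => by rw [← hθw]; exact hUdef i x hx) e).trans (hmax ?_)
    exact ⟨fun j => Finset.sum_nonneg fun i _ => hx.1.1 i j, hx.1.2⟩
  refine hup.trans ?_
  obtain ⟨hx, hmin⟩ := hxs fun _ _ => p - c
  set x := xs fun _ _ => p - c
  have hcost : ∑ i, ∑ j, (e j + c) * y i j = ∑ j, (e j + c) * Y j := by
    rw [Finset.sum_comm]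
    simp only [← Finset.mul_sum, hcol]
  have htot : ∑ i, ∑ j, x i j = T := by
    simp only [huniq x hx]
    rw [Finset.sum_comm]
    simp only [hcol, hT_def]
  have hprofit : totalProfit (fun _ _ => p - c) e x
      = p * T - ∑ i, ∑ j, (e j + c) * x i j := by
    rw [← htot]
    simp only [totalProfit, Finset.mul_sum, ← Finset.sum_sub_distrib]
    exact Finset.sum_congr rfl fun i _ => Finset.sum_congr rfl fun j _ => by ring
  rw [hYval, hprofit]
  linarith [hmin y hyopt]
end

section
/- Proposition (existence of a quantity competition equilibrium). Consider the QCG and suppose that, for every MNO n, the map q ↦ q·π(q + s) − Ẽ_n(q) is differentiable and strictly quasi-concave on Q_n for every fixed s ≥ 0, and the map q ↦ q·π(b) + (q²/2)·π'(b) − Ẽ_n(q) is strictly quasi-concave on Q_n for every b ∈ [0, Σ_{i∈I} C_i]. Then Φ is a continuous self-map of [0, Σ_{i∈I} C_i], it has a fixed point b*, and the profile q* with q_n* = φ_n(b*) is a QCE; in particular the QCG always admits at least one QCE. -/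
open Finset

/-- Strict quasi-concavity of a real function on a set. -/
def StrictQuasiconcaveOn' (f : ℝ → ℝ) (s : Set ℝ) : Prop :=
  ∀ ⦃x⦄, x ∈ s → ∀ ⦃y⦄, y ∈ s → x ≠ y → ∀ ⦃a b : ℝ⦄, 0 < a → 0 < b → a + b = 1 →
    min (f x) (f y) < f (a * x + b * y)

/-- `x` maximizes `f` over `s`. -/
def IsArgmaxOn (f : ℝ → ℝ) (s : Set ℝ) (x : ℝ) : Prop :=
  x ∈ s ∧ ∀ y ∈ s, f y ≤ f x

/-- Quantity competition equilibrium: each MNO `n`'s output `q n ∈ [0, Qcap n]` is a best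
response given the other MNOs' total output, with uniform delivered price `pi` and aggregate
costs `E`. -/
def IsQCE {N : Type*} [Fintype N] [DecidableEq N] (Qcap : N → ℝ) (pi : ℝ → ℝ)
    (E : N → ℝ → ℝ) (q : N → ℝ) : Prop :=
  (∀ n, q n ∈ Set.Icc 0 (Qcap n)) ∧
  ∀ n, ∀ qn ∈ Set.Icc 0 (Qcap n),
    qn * pi (qn + ∑ ℓ ∈ Finset.univ.erase n, q ℓ) - E n qn ≤
      q n * pi (∑ ℓ, q ℓ) - E n (q n)

section Lemmas

open Filter Topology

theorem StrictQuasiconcaveOn'.eq_of_isArgmaxOn {f : ℝ → ℝ} {s : Set ℝ} (hs : Convex ℝ s)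
    (hf : StrictQuasiconcaveOn' f s) {x y : ℝ} (hx : IsArgmaxOn f s x) (hy : IsArgmaxOn f s y) :
    x = y := by
  by_contra hne
  have hlt := hf hx.1 hy.1 hne (a := 1 / 2) (b := 1 / 2) (by norm_num) (by norm_num) (by norm_num)
  have hmem : (1 / 2 : ℝ) * x + 1 / 2 * y ∈ s :=
    hs hx.1 hy.1 (by norm_num) (by norm_num) (by norm_num)
  rw [min_eq_left (hy.2 x hx.1)] at hlt
  exact (hx.2 _ hmem).not_gt hlt

/-- The slope of `f` along the segment from `x` to `y` tends to the directional derivative. -/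
theorem tendsto_slope_along_segment {f : ℝ → ℝ} {f' x : ℝ} (hf : HasDerivAt f f' x) (y : ℝ) :
    Tendsto (fun t : ℝ => t⁻¹ * (f (x + t * (y - x)) - f x)) (𝓝[>] 0) (𝓝 (f' * (y - x))) := by
  have hline : HasDerivAt (fun t : ℝ => x + t * (y - x)) (y - x) 0 := by
    simpa using ((hasDerivAt_id (0 : ℝ)).mul_const (y - x)).const_add x
  have hcomp : HasDerivAt (fun t : ℝ => f (x + t * (y - x))) (f' * (y - x)) 0 :=
    HasDerivAt.comp (h₂ := f) (0 : ℝ) (by simpa using hf) hline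
  simpa using hcomp.tendsto_slope_zero_right

theorem segment_mem {s : Set ℝ} (hs : Convex ℝ s) {x y t : ℝ} (hx : x ∈ s) (hy : y ∈ s)
    (h0 : 0 ≤ t) (h1 : t ≤ 1) : x + t * (y - x) ∈ s := by
  have := hs hx hy (sub_nonneg.2 h1) h0 (sub_add_cancel 1 t)
  convert this using 1
  simp only [smul_eq_mul]
  ring

theorem eventually_mem_Ioo_zero_one : ∀ᶠ t : ℝ in 𝓝[>] 0, t ∈ Set.Ioo (0 : ℝ) 1 :=
  Ioo_mem_nhdsGT one_pos

/-- First-order necessary condition on a convex set. -/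
theorem IsArgmaxOn.hasDerivAt_mul_sub_nonpos {f : ℝ → ℝ} {s : Set ℝ} (hs : Convex ℝ s)
    {f' x y : ℝ} (hx : IsArgmaxOn f s x) (hf : HasDerivAt f f' x) (hy : y ∈ s) :
    f' * (y - x) ≤ 0 := by
  refine le_of_tendsto (tendsto_slope_along_segment hf y) ?_
  filter_upwards [eventually_mem_Ioo_zero_one] with t ht
  exact mul_nonpos_of_nonneg_of_nonpos (inv_nonneg.2 ht.1.le)
    (sub_nonpos.2 (hx.2 _ (segment_mem hs hx.1 hy ht.1.le ht.2.le)))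

/-- A strictly quasi-concave function does not decrease to first order in the direction of a
point with a larger value. -/
theorem StrictQuasiconcaveOn'.hasDerivAt_mul_sub_nonneg {f : ℝ → ℝ} {s : Set ℝ}
    (hqc : StrictQuasiconcaveOn' f s) {f' x y : ℝ} (hx : x ∈ s) (hy : y ∈ s)
    (hf : HasDerivAt f f' x) (hlt : f x < f y) : 0 ≤ f' * (y - x) := by
  refine ge_of_tendsto (tendsto_slope_along_segment hf y) ?_
  filter_upwards [eventually_mem_Ioo_zero_one] with t ht
  have hne : x ≠ y := fun h => hlt.ne (congrArg f h)
  have h := hqc hx hy hne (sub_pos.2 ht.2) ht.1 (sub_add_cancel 1 t)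
  rw [min_eq_left hlt.le, show (1 - t) * x + t * y = x + t * (y - x) by ring] at h
  exact mul_nonneg (inv_nonneg.2 ht.1.le) (sub_nonneg.2 h.le)

theorem ConvexOn.add_hasDerivAt_mul_sub_le {f : ℝ → ℝ} {s : Set ℝ} (hf : ConvexOn ℝ s f)
    {f' x y : ℝ} (hx : x ∈ s) (hy : y ∈ s) (hd : HasDerivAt f f' x) :
    f x + f' * (y - x) ≤ f y := by
  suffices h : f' * (y - x) ≤ f y - f x by linarith
  refine le_of_tendsto (tendsto_slope_along_segment hd y) ?_
  filter_upwards [eventually_mem_Ioo_zero_one] with t ht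
  have h := hf.2 hx hy (sub_pos.2 ht.2).le ht.1.le (sub_add_cancel 1 t)
  simp only [smul_eq_mul] at h
  rw [show (1 - t) * x + t * y = x + t * (y - x) by ring] at h
  rw [inv_mul_le_iff₀ ht.1]
  linarith

/-- A selection of unique maximizers over a compact set of a jointly continuous function is
continuous in the parameter. -/
theorem continuousOn_of_unique_isArgmaxOn {G : ℝ → ℝ → ℝ}
    (hG : Continuous fun p : ℝ × ℝ => G p.1 p.2) {K B : Set ℝ} (hK : IsCompact K) {φ : ℝ → ℝ}
    (hφ : ∀ b ∈ B, IsArgmaxOn (G b) K (φ b))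
    (huniq : ∀ b ∈ B, ∀ y, IsArgmaxOn (G b) K y → y = φ b) : ContinuousOn φ B := by
  intro b hb
  refine hK.tendsto_nhds_of_unique_mapClusterPt
    (eventually_mem_nhdsWithin.mono fun c hc => (hφ c hc).1) fun y hy hclus => ?_
  refine huniq b hb y ⟨hy, fun z hz => ?_⟩
  by_contra! hlt
  have hopen : IsOpen {p : ℝ × ℝ | G p.1 p.2 < G p.1 z} :=
    isOpen_lt hG (hG.comp (continuous_fst.prodMk continuous_const))
  obtain ⟨U, hU, V, hV, hUV⟩ := mem_nhds_prod_iff.1 (hopen.mem_nhds (x := (b, y)) hlt)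
  have hfreq := mapClusterPt_iff_frequently.1 hclus V hV
  obtain ⟨c, hcV, hcU, hcB⟩ :=
    (hfreq.and_eventually
      ((eventually_nhdsWithin_of_eventually_nhds hU).and eventually_mem_nhdsWithin)).exists
  have hc : G c (φ c) < G c z := hUV (Set.mk_mem_prod hcU hcV)
  exact ((hφ c hcB).2 z hz).not_gt hc

section Firm

variable {p p' c c' : ℝ → ℝ} {Q : ℝ}

theorem hasDerivAt_profit (hp : ∀ b, HasDerivAt p (p' b) b) (hc : ∀ q, HasDerivAt c (c' q) q)
    (s q : ℝ) :
    HasDerivAt (fun q => q * p (q + s) - c q) (p (q + s) + q * p' (q + s) - c' q) q := by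
  have h1 : HasDerivAt (fun q => p (q + s)) (p' (q + s)) q :=
    (hp (q + s)).comp_add_const q s
  exact (((hasDerivAt_id q).mul h1).sub (hc q)).congr_deriv (by simp)

theorem hasDerivAt_quadratic_surrogate (hc : ∀ q, HasDerivAt c (c' q) q) (u v q : ℝ) :
    HasDerivAt (fun q => q * u + q ^ 2 / 2 * v - c q) (u + q * v - c' q) q := by
  have h1 : HasDerivAt (fun q : ℝ => q ^ 2 / 2 * v) (q * v) q :=
    ((((hasDerivAt_id q).pow 2).div_const 2).mul_const v).congr_deriv (by simp)
  exact ((((hasDerivAt_id q).mul_const u).add h1).sub (hc q)).congr_deriv (by simp)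

/-- The first-order condition is sufficient for maximality in the quadratic surrogate problem. -/
theorem isArgmaxOn_quadratic_surrogate (hc : ∀ q, HasDerivAt c (c' q) q)
    (hconv : ConvexOn ℝ (Set.Icc 0 Q) c) {u v x : ℝ} (hv : v ≤ 0) (hx : x ∈ Set.Icc 0 Q)
    (hfoc : ∀ y ∈ Set.Icc 0 Q, (u + x * v - c' x) * (y - x) ≤ 0) :
    IsArgmaxOn (fun q => q * u + q ^ 2 / 2 * v - c q) (Set.Icc 0 Q) x := by
  refine ⟨hx, fun y hy => ?_⟩
  have h1 := hconv.add_hasDerivAt_mul_sub_le hx hy (hc x)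
  have h2 := hfoc y hy
  have h3 := mul_nonpos_of_nonneg_of_nonpos (sq_nonneg (y - x)) hv
  dsimp only
  linarith

/-- A maximizer of the quadratic surrogate at total output `q + s` beats, in the true profit given
the others' output `s`, every feasible quantity, except possibly larger ones when `s = 0`.

The surrogate is strictly concave, so moving from `q` towards `y` at constant total output makes
the first-order condition strict; quasi-concavity then applies, and one passes to the limit. -/
theorem profit_le_of_isArgmaxOn_surrogate (hp : ∀ b, HasDerivAt p (p' b) b)
    (hp' : ∀ b, p' b < 0) (hc : ∀ q, HasDerivAt c (c' q) q)
    (hconv : ConvexOn ℝ (Set.Icc 0 Q) c)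
    (hqc : ∀ s, 0 ≤ s →
      StrictQuasiconcaveOn' (fun q => q * p (q + s) - c q) (Set.Icc 0 Q))
    {q s y : ℝ} (hs : 0 ≤ s)
    (hq : IsArgmaxOn (fun x => x * p (q + s) + x ^ 2 / 2 * p' (q + s) - c x) (Set.Icc 0 Q) q)
    (hy : y ∈ Set.Icc 0 Q) (hys : q < y → 0 < s) :
    y * p (y + s) - c y ≤ q * p (q + s) - c q := by
  rcases eq_or_ne y q with rfl | hne
  · rfl
  have hfoc := hq.hasDerivAt_mul_sub_nonpos (convex_Icc 0 Q)
    (hasDerivAt_quadratic_surrogate hc _ _ q) hy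
  have hpc : Continuous p := continuous_iff_continuousAt.2 fun b => (hp b).continuousAt
  have hcc : Continuous c := continuous_iff_continuousAt.2 fun b => (hc b).continuousAt
  have hlhs : Tendsto (fun t : ℝ => y * p (y + (s - t * (y - q))) - c y) (𝓝[>] 0)
      (𝓝 (y * p (y + s) - c y)) := by
    have h : Continuous fun t : ℝ => y * p (y + (s - t * (y - q))) - c y := by fun_prop
    simpa using (h.tendsto 0).mono_left nhdsWithin_le_nhds
  have hrhs : Tendsto (fun t : ℝ => (q + t * (y - q)) * p (q + t * (y - q) + (s - t * (y - q)))
      - c (q + t * (y - q))) (𝓝[>] 0) (𝓝 (q * p (q + s) - c q)) := by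
    have h : Continuous fun t : ℝ => (q + t * (y - q)) * p (q + t * (y - q) + (s - t * (y - q)))
      - c (q + t * (y - q)) := by fun_prop
    simpa using (h.tendsto 0).mono_left nhdsWithin_le_nhds
  have hst : ∀ᶠ t : ℝ in 𝓝[>] 0, 0 ≤ s - t * (y - q) := by
    rcases hne.lt_or_gt with hlt | hgt
    · filter_upwards [self_mem_nhdsWithin] with t ht
      nlinarith [mul_pos (Set.mem_Ioi.1 ht) (sub_pos.2 hlt)]
    · have h : Continuous fun t : ℝ => s - t * (y - q) := by fun_prop
      have h0 : ∀ᶠ t : ℝ in 𝓝 0, 0 < s - t * (y - q) :=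
        h.continuousAt.eventually_const_lt (by simpa using hys hgt)
      exact (h0.filter_mono nhdsWithin_le_nhds).mono fun t ht => ht.le
  refine le_of_tendsto_of_tendsto hlhs hrhs ?_
  filter_upwards [hst, eventually_mem_Ioo_zero_one] with t hst ht
  have hmem := segment_mem (convex_Icc 0 Q) hq.1 hy ht.1.le ht.2.le
  by_contra! hlt
  have hdir := (hqc _ hst).hasDerivAt_mul_sub_nonneg hmem hy (hasDerivAt_profit hp hc _ _) hlt
  rw [show q + t * (y - q) + (s - t * (y - q)) = q + s by ring] at hdir
  have h1 := hconv.add_hasDerivAt_mul_sub_le hq.1 hmem (hc q)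
  have h2 := hconv.add_hasDerivAt_mul_sub_le hmem hq.1 (hc (q + t * (y - q)))
  have hmono : 0 ≤ (c' (q + t * (y - q)) - c' q) * (y - q) := by
    refine nonneg_of_mul_nonneg_right (a := t) ?_ ht.1
    linarith
  have hneg : t * (y - q) ^ 2 * p' (q + s) < 0 :=
    mul_neg_of_pos_of_neg (mul_pos ht.1 (sq_pos_of_ne_zero (sub_ne_zero.2 hne))) (hp' _)
  have hdir' : 0 ≤ (p (q + s) + (q + t * (y - q)) * p' (q + s) - c' (q + t * (y - q)))
      * (y - q) := by
    refine nonneg_of_mul_nonneg_right (a := 1 - t) ?_ (sub_pos.2 ht.2)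
    linarith
  linarith

end Firm

end Lemmas

/-- **Proposition (existence of a quantity competition equilibrium).**  Under the stated
assumptions, `Φ = ∑ n, φ n` is a continuous self-map of `[0, M]` with `M = ∑ n, Qcap n`, it
has a fixed point `bstar`, and `q n = φ n bstar` is a QCE; in particular the QCG always admits
at least one QCE. -/
theorem QCE_exists
    (N : Type) [Fintype N] [DecidableEq N] [Nonempty N]
    (Qcap : N → ℝ) (hQ : ∀ n, 0 < Qcap n)
    (M : ℝ) (hMdef : M = ∑ n, Qcap n)
    (pi pi' : ℝ → ℝ)
    (hpider : ∀ b, HasDerivAt pi (pi' b) b)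
    (hpi'cont : Continuous pi')
    (hpi'neg : ∀ b, pi' b < 0)
    (hrev : StrictQuasiconcaveOn' (fun x => x * pi x) (Set.Ici 0))
    (E E' : N → ℝ → ℝ)
    (hEder : ∀ n q, HasDerivAt (E n) (E' n q) q)
    (hE'cont : ∀ n, Continuous (E' n))
    (hEconv : ∀ n, ConvexOn ℝ (Set.Icc 0 (Qcap n)) (E n))
    (hqc1 : ∀ n s, 0 ≤ s →
      DifferentiableOn ℝ (fun q => q * pi (q + s) - E n q) (Set.Icc 0 (Qcap n)) ∧
      StrictQuasiconcaveOn' (fun q => q * pi (q + s) - E n q) (Set.Icc 0 (Qcap n)))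
    (hqc2 : ∀ n b, b ∈ Set.Icc 0 M →
      StrictQuasiconcaveOn' (fun q => q * pi b + q ^ 2 / 2 * pi' b - E n q)
        (Set.Icc 0 (Qcap n)))
    (φ : N → ℝ → ℝ)
    (hφ : ∀ n, ∀ b ∈ Set.Icc 0 M,
      IsArgmaxOn (fun q => q * pi b + q ^ 2 / 2 * pi' b - E n q)
        (Set.Icc 0 (Qcap n)) (φ n b)) :
    ContinuousOn (fun b => ∑ n, φ n b) (Set.Icc 0 M) ∧
    (∀ b ∈ Set.Icc 0 M, (∑ n, φ n b) ∈ Set.Icc 0 M) ∧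
    ∃ bstar ∈ Set.Icc 0 M, (∑ n, φ n bstar) = bstar ∧
      IsQCE Qcap pi E (fun n => φ n bstar) := by
  have hpi : Continuous pi := continuous_iff_continuousAt.2 fun b => (hpider b).continuousAt
  have hE : ∀ n, Continuous (E n) := fun n =>
    continuous_iff_continuousAt.2 fun q => (hEder n q).continuousAt
  have hQM : ∀ n, Qcap n ≤ M := fun n => by
    rw [hMdef]
    exact Finset.single_le_sum (fun i _ => (hQ i).le) (Finset.mem_univ n)
  have hM : 0 ≤ M := by
    rw [hMdef]
    exact Finset.sum_nonneg fun i _ => (hQ i).le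
  have huniq : ∀ n, ∀ b ∈ Set.Icc 0 M, ∀ y,
      IsArgmaxOn (fun q => q * pi b + q ^ 2 / 2 * pi' b - E n q) (Set.Icc 0 (Qcap n)) y →
        y = φ n b := fun n b hb y hy =>
    (hqc2 n b hb).eq_of_isArgmaxOn (convex_Icc _ _) hy (hφ n b hb)
  have hcont : ContinuousOn (fun b => ∑ n, φ n b) (Set.Icc 0 M) := by
    refine continuousOn_finsetSum _ fun n _ => ?_
    refine continuousOn_of_unique_isArgmaxOn
      (G := fun b q => q * pi b + q ^ 2 / 2 * pi' b - E n q) ?_ isCompact_Icc (hφ n) (huniq n)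
    have := hE n
    fun_prop
  have hmaps : ∀ b ∈ Set.Icc 0 M, (∑ n, φ n b) ∈ Set.Icc 0 M := fun b hb => by
    refine ⟨Finset.sum_nonneg fun n _ => (hφ n b hb).1.1, ?_⟩
    rw [hMdef]
    exact Finset.sum_le_sum fun n _ => (hφ n b hb).1.2
  refine ⟨hcont, hmaps, ?_⟩
  obtain ⟨b, hb, hfix⟩ := exists_mem_Icc_isFixedPt_of_mapsTo hcont hM hmaps
  replace hfix : ∑ n, φ n b = b := hfix
  have hsplit : ∀ (q : N → ℝ) n, q n + ∑ ℓ ∈ Finset.univ.erase n, q ℓ = ∑ ℓ, q ℓ :=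
    fun q n => Finset.add_sum_erase _ _ (Finset.mem_univ n)
  have hothers : ∀ d ∈ Set.Icc 0 M, ∀ n, 0 ≤ ∑ ℓ ∈ Finset.univ.erase n, φ ℓ d :=
    fun d hd n => Finset.sum_nonneg fun ℓ _ => (hφ ℓ d hd).1.1
  have hresp : ∀ d ∈ Set.Icc 0 M, ∑ ℓ, φ ℓ d = d → ∀ n, ∀ y ∈ Set.Icc 0 (Qcap n),
      (φ n d < y → 0 < ∑ ℓ ∈ Finset.univ.erase n, φ ℓ d) →
      y * pi (y + ∑ ℓ ∈ Finset.univ.erase n, φ ℓ d) - E n y ≤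
        φ n d * pi (∑ ℓ, φ ℓ d) - E n (φ n d) := fun d hd hsum n y hy hys => by
    have hmax := hφ n d hd
    have htot := (hsplit (fun ℓ => φ ℓ d) n).trans hsum
    rw [hsum, ← congrArg pi htot]
    refine profit_le_of_isArgmaxOn_surrogate hpider hpi'neg (hEder n) (hEconv n)
      (fun s hs => (hqc1 n s hs).2) (hothers d hd n) ?_ hy hys
    rw [htot]
    exact hmax
  by_cases hqce : IsQCE Qcap pi E fun n => φ n b
  · exact ⟨b, hb, hfix, hqce⟩
  -- Otherwise some firm `n` is alone in the market; replace its output by the monopoly output `X`.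
  obtain ⟨n, y, hy, hlt⟩ : ∃ n, ∃ y ∈ Set.Icc 0 (Qcap n), φ n b * pi (∑ ℓ, φ ℓ b) - E n (φ n b) <
      y * pi (y + ∑ ℓ ∈ Finset.univ.erase n, φ ℓ b) - E n y := by
    by_contra! h
    exact hqce ⟨fun n => (hφ n b hb).1, h⟩
  have hzero : ∑ ℓ ∈ Finset.univ.erase n, φ ℓ b = 0 := by
    by_contra hne
    exact (hresp b hb hfix n y hy fun _ => (hothers b hb n).lt_of_ne' hne).not_gt hlt
  obtain ⟨X, hX, hXmax⟩ := (isCompact_Icc (a := (0 : ℝ)) (b := Qcap n)).exists_isMaxOn ⟨y, hy⟩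
    (f := fun q => q * pi (q + 0) - E n q) (by have := hE n; fun_prop)
  replace hXmax : IsArgmaxOn (fun q => q * pi (q + 0) - E n q) (Set.Icc 0 (Qcap n)) X :=
    ⟨hX, fun z hz => hXmax hz⟩
  have hbn : φ n b = b := by
    have := hsplit (fun ℓ => φ ℓ b) n
    linarith
  have hbX : b < X := by
    by_contra! hle
    have h1 := hresp b hb hfix n X hX fun h => absurd h (by linarith)
    have h2 := hXmax.2 y hy
    rw [hzero] at h1 hlt
    dsimp only at h2
    linarith
  have hX0 : 0 < X := hb.1.trans_lt hbX
  have hXM : X ∈ Set.Icc 0 M := ⟨hX.1, hX.2.trans (hQM n)⟩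
  have hφn : φ n X = X := by
    refine (huniq n X hXM X ?_).symm
    refine isArgmaxOn_quadratic_surrogate (hEder n) (hEconv n) (hpi'neg X).le hX fun z hz => ?_
    have := hXmax.hasDerivAt_mul_sub_nonpos (convex_Icc _ _)
      (hasDerivAt_profit hpider (hEder n) 0 X) hz
    simpa using this
  have hφl : ∀ ℓ, ℓ ≠ n → φ ℓ X = 0 := fun ℓ hℓ => by
    have hℓ0 : φ ℓ b = 0 :=
      (Finset.sum_eq_zero_iff_of_nonneg fun i _ => (hφ i b hb).1.1).1 hzero ℓ
        (Finset.mem_erase.2 ⟨hℓ, Finset.mem_univ ℓ⟩)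
    have hmax := hφ ℓ b hb
    rw [hℓ0] at hmax
    refine (huniq ℓ X hXM 0 ?_).symm
    refine isArgmaxOn_quadratic_surrogate (hEder ℓ) (hEconv ℓ) (hpi'neg X).le hmax.1
      fun z hz => ?_
    have hfoc := hmax.hasDerivAt_mul_sub_nonpos (convex_Icc _ _)
      (hasDerivAt_quadratic_surrogate (hEder ℓ) _ _ 0) hz
    have hanti : pi X < pi b :=
      strictAnti_of_deriv_neg (fun x => (hpider x).deriv.trans_lt (hpi'neg x)) hbX
    have := mul_le_mul_of_nonneg_right hanti.le hz.1
    linarith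
  have hother0 : ∑ ℓ ∈ Finset.univ.erase n, φ ℓ X = 0 :=
    Finset.sum_eq_zero fun ℓ hℓ => hφl ℓ (Finset.ne_of_mem_erase hℓ)
  have hsumX : ∑ ℓ, φ ℓ X = X := by
    have := hsplit (fun ℓ => φ ℓ X) n
    linarith
  refine ⟨X, hXM, hsumX, fun ℓ => (hφ ℓ X hXM).1, fun ℓ z hz => ?_⟩
  rcases eq_or_ne ℓ n with rfl | hℓ
  · have := hXmax.2 z hz
    dsimp only at this ⊢
    rw [hother0, hsumX, hφn]
    simpa using this
  · refine hresp X hXM hsumX ℓ z hz fun _ => ?_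
    have := hsplit (fun ℓ => φ ℓ X) ℓ
    rw [hφl ℓ hℓ, zero_add] at this
    linarith
end

section
/- Proposition (convergence of the mean-value iterative dynamics). Let M > 0 and let f : [0, M] → [0, M] be continuous. Pick any b(1) ∈ [0, M] and define recursively b(t+1) = (1/t)·f(b(t)) + (1 − 1/t)·b(t) for t ≥ 1. Then the sequence (b(t))_{t≥1} converges to a point b* ∈ [0, M] satisfying f(b*) = b*. In particular, applied to f = Φ (normalized to a self-map of an interval), Algorithm 2 converges to a fixed point of Φ and hence to a QCE of the quantity competition game, without requiring uniqueness of the equilibrium. -/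
open Filter Topology

/-- A real sequence that from some rank on never leaves `s` once inside it cannot be frequently
in `s` and frequently outside `s`. -/
lemma not_frequently_notMem_of_eventually_stable {x : ℕ → ℝ} {s : Set ℝ}
    (hstable : ∀ᶠ n in atTop, x n ∈ s → x (n + 1) ∈ s) (hs : ∃ᶠ n in atTop, x n ∈ s) :
    ¬ ∃ᶠ n in atTop, x n ∉ s := by
  obtain ⟨N, hN⟩ := eventually_atTop.1 hstable
  obtain ⟨n, hn, hxn⟩ := frequently_atTop.1 hs N
  refine not_frequently.2 (eventually_atTop.2 ⟨n, fun m hm => not_not.2 ?_⟩)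
  induction m, hm using Nat.le_induction with
  | base => exact hxn
  | succ m hm ih => exact hN m (hn.trans hm) ih

/-- A bounded sequence with vanishing increments, each having the sign of `g` at the current
point, converges as soon as `g` is continuous inside the interval. -/
lemma exists_tendsto_of_increment_sign {x : ℕ → ℝ} {g : ℝ → ℝ} {l u : ℝ}
    (hg : ContinuousOn g (Set.Ioo l u)) (hx : ∀ᶠ n in atTop, x n ∈ Set.Icc l u)
    (hstep : Tendsto (fun n => x (n + 1) - x n) atTop (𝓝 0))
    (hpos : ∀ᶠ n in atTop, 0 ≤ g (x n) → x n ≤ x (n + 1))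
    (hneg : ∀ᶠ n in atTop, g (x n) ≤ 0 → x (n + 1) ≤ x n) :
    ∃ y, Tendsto x atTop (𝓝 y) := by
  refine tendsto_of_no_upcrossings dense_univ ?_
    (isBoundedUnder_of_eventually_le (hx.mono fun _ h => h.2))
    (isBoundedUnder_of_eventually_ge (hx.mono fun _ h => h.1))
  rintro a - b - hab ⟨ha, hb⟩
  obtain ⟨n, hna, hn⟩ := (ha.and_eventually hx).exists
  obtain ⟨m, hmb, hm⟩ := (hb.and_eventually hx).exists
  by_cases h : ∃ c ∈ Set.Ioo a b, 0 < g c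
  · obtain ⟨c, hc, hgc⟩ := h
    have hcont : ContinuousAt g c := hg.continuousAt
      (Ioo_mem_nhds (hn.1.trans_lt (hna.trans hc.1)) (hc.2.trans (hmb.trans_le hm.2)))
    obtain ⟨δ, hδ, hball⟩ := Metric.eventually_nhds_iff.1 (hcont.eventually_const_lt hgc)
    refine not_frequently_notMem_of_eventually_stable (s := Set.Ici c) ?_
      (hb.mono fun _ h => (hc.2.trans h).le) (ha.mono fun _ h => (h.trans hc.1).not_ge)
    filter_upwards [hpos, hstep.eventually_const_lt (neg_lt_zero.2 hδ)] with k hk hk' hck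
    rw [Set.mem_Ici] at hck ⊢
    rcases lt_or_ge (x k) (c + δ) with hlt | hge
    · refine hck.trans (hk (hball ?_).le)
      rw [Real.dist_eq, abs_of_nonneg (sub_nonneg.2 hck)]
      linarith
    · linarith
  · push Not at h
    obtain ⟨d, had, hdb⟩ := exists_between hab
    refine not_frequently_notMem_of_eventually_stable (s := Set.Iic d) ?_
      (ha.mono fun _ h => (h.trans had).le) (hb.mono fun _ h => (hdb.trans h).not_ge)
    filter_upwards [hneg, hstep.eventually_lt_const (sub_pos.2 had)] with k hk hk' hkd
    rw [Set.mem_Iic] at hkd ⊢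
    rcases lt_or_ge a (x k) with hlt | hge
    · exact (hk (h _ ⟨hlt, hkd.trans_lt hdb⟩)).trans hkd
    · linarith

/-- **Proposition (convergence of the mean-value iterative dynamics).**  For any continuous
self-map `f` of the compact interval `[0, M]`, the Mann-type mean-value iteration
`b (t+1) = (1/t) * f (b t) + (1 - 1/t) * b t` (for `t ≥ 1`, starting from any `b 1 ∈ [0, M]`)
converges to a fixed point of `f`.  (Applied to the map `Φ` of the quantity competition game,
Algorithm 2 converges to a QCE, without requiring uniqueness of the equilibrium.) -/
theorem mean_value_iteration_converges
    (M : ℝ) (hM : 0 < M)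
    (f : ℝ → ℝ)
    (hf : ContinuousOn f (Set.Icc 0 M))
    (hmaps : ∀ x ∈ Set.Icc (0:ℝ) M, f x ∈ Set.Icc (0:ℝ) M)
    (b : ℕ → ℝ)
    (hb1 : b 1 ∈ Set.Icc (0:ℝ) M)
    (hrec : ∀ t : ℕ, 1 ≤ t →
      b (t + 1) = (1 / (t : ℝ)) * f (b t) + (1 - 1 / (t : ℝ)) * b t) :
    ∃ bstar ∈ Set.Icc (0:ℝ) M,
      Filter.Tendsto b Filter.atTop (nhds bstar) ∧ f bstar = bstar := by
  have hmem : ∀ t, 1 ≤ t → b t ∈ Set.Icc 0 M := by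
    intro t ht
    induction t, ht using Nat.le_induction with
    | base => exact hb1
    | succ t ht ih =>
      have ht' : (1 : ℝ) ≤ t := by exact_mod_cast ht
      rw [hrec t ht]
      exact convex_Icc 0 M (hmaps _ ih) ih (by positivity)
        (sub_nonneg.2 ((div_le_one (by positivity)).2 ht')) (by ring)
  have hincr : ∀ t, 1 ≤ t → b (t + 1) - b t = 1 / (t : ℝ) * (f (b t) - b t) := by
    intro t ht
    rw [hrec t ht]
    ring
  have hstep : Tendsto (fun t => b (t + 1) - b t) atTop (𝓝 0) := by
    refine squeeze_zero_norm' ?_ (tendsto_const_div_atTop_nhds_zero_nat M)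
    filter_upwards [eventually_ge_atTop 1] with t ht
    have hb := hmem t ht
    have hfb := hmaps _ hb
    rw [hincr t ht, norm_mul, Real.norm_of_nonneg (by positivity : (0 : ℝ) ≤ 1 / t),
      div_mul_eq_mul_div, one_mul]
    gcongr
    exact abs_le.2 ⟨by linarith [hb.2, hfb.1], by linarith [hb.1, hfb.2]⟩
  obtain ⟨y, hy⟩ := exists_tendsto_of_increment_sign (x := b) (g := fun z => f z - z)
    ((hf.mono Set.Ioo_subset_Icc_self).sub continuousOn_id)
    (eventually_atTop.2 ⟨1, hmem⟩) hstep
    (by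
      filter_upwards [eventually_ge_atTop 1] with t ht hg
      rw [← sub_nonneg, hincr t ht]
      exact mul_nonneg (by positivity) hg)
    (by
      filter_upwards [eventually_ge_atTop 1] with t ht hg
      rw [← sub_nonpos, hincr t ht]
      exact mul_nonpos_of_nonneg_of_nonpos (by positivity) hg)
  have hyM : y ∈ Set.Icc 0 M := isClosed_Icc.mem_of_tendsto hy (eventually_atTop.2 ⟨1, hmem⟩)
  refine ⟨y, hyM, hy, ?_⟩
  have hsum : ∀ n : ℕ, (n : ℝ) * b (n + 1) = ∑ i ∈ Finset.range n, f (b (i + 1)) := by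
    intro n
    induction n with
    | zero => simp
    | succ n ih =>
      rw [Finset.sum_range_succ, ← ih, hrec (n + 1) (by omega)]
      push_cast
      field_simp
      ring
  have hfb : Tendsto (fun n => f (b (n + 1))) atTop (𝓝 (f y)) :=
    (hf y hyM).tendsto.comp (tendsto_nhdsWithin_iff.2
      ⟨hy.comp (tendsto_add_atTop_nat 1), Eventually.of_forall fun n => hmem _ (by omega)⟩)
  refine tendsto_nhds_unique (hfb.cesaro.congr' ?_) (hy.comp (tendsto_add_atTop_nat 1))
  filter_upwards [eventually_ne_atTop 0] with n hn
  rw [← hsum n, inv_mul_cancel_left₀ (Nat.cast_ne_zero.2 hn)]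
  rfl
end
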